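/- Let Q₂ be the presentation ⟨a, b, r, t | a^b a⁻², [t,a], [r,at]⟩. There is a constant C > 0, depending only on Q₂, such that every null-homotopic word w over Q₂ satisfies FL(w) ≤ C·ℓ(w): w can be converted to the empty word by free reductions, free expansions and applications of relators of Q₂ with every intermediate word of length at most C·ℓ(w). -/

import Mathlib

/-! Words over an alphabet `A`: a letter `(x, true)` is the generator `x`,
and `(x, false)` is its formal inverse `x⁻¹`. -/

/-- A word over the alphabet `A ∪ A⁻¹`. -/
abbrev Word (A : Type*) := List (A × Bool)

namespace Word

/-- The formal inverse of a word. -/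
def inv {A : Type*} (w : Word A) : Word A := (w.map fun p => (p.1, !p.2)).reverse

/-- `w'` is a cyclic conjugate (cyclic permutation) of `w`. -/
def IsCyclicConj {A : Type*} (w w' : Word A) : Prop :=
  ∃ u v : Word A, w = u ++ v ∧ w' = v ++ u

end Word

/-- Moves (i)–(iii) on words with respect to a set `R` of relator words:
free reduction, free expansion, and application of a relator (replace a subword `u`
by `v` where some cyclic conjugate of `u * v⁻¹` lies in `R ∪ R⁻¹`). -/
inductive Move {A : Type*} (R : Set (Word A)) : Word A → Word A → Prop
  | freeReduce (u v : Word A) (x : A) (b : Bool) :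
      Move R (u ++ (x, b) :: (x, !b) :: v) (u ++ v)
  | freeExpand (u v : Word A) (x : A) (b : Bool) :
      Move R (u ++ v) (u ++ (x, b) :: (x, !b) :: v)
  | relator (p q u v z : Word A)
      (hz : Word.IsCyclicConj (u ++ Word.inv v) z) (hR : z ∈ R ∨ Word.inv z ∈ R) :
      Move R (p ++ u ++ q) (p ++ v ++ q)

/-- Moves (i)–(iv): moves (i)–(iii) together with cyclic conjugation. -/
inductive MoveC {A : Type*} (R : Set (Word A)) : Word A → Word A → Prop
  | of {w w' : Word A} : Move R w w' → MoveC R w w'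
  | cyc {w w' : Word A} : Word.IsCyclicConj w w' → MoveC R w w'

/-- Moves (i)–(v) on finite sequences of words: one of the moves (i)–(iv) applied to
one word of the sequence, or fragmentation of one word `u ++ v` into `u` and `v`. -/
inductive MoveF {A : Type*} (R : Set (Word A)) : List (Word A) → List (Word A) → Prop
  | of (l₁ l₂ : List (Word A)) {w w' : Word A} :
      MoveC R w w' → MoveF R (l₁ ++ w :: l₂) (l₁ ++ w' :: l₂)
  | frag (l₁ l₂ : List (Word A)) (u v : Word A) :
      MoveF R (l₁ ++ (u ++ v) :: l₂) (l₁ ++ u :: v :: l₂)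

/-- A word is null-homotopic over the presentation with relator set `R` if it represents
the identity of the presented group, i.e. lies in the normal closure of the relators. -/
def NullHomotopic {A : Type*} (R : Set (Word A)) (w : Word A) : Prop :=
  FreeGroup.mk w ∈ Subgroup.normalClosure (FreeGroup.mk '' R)

/-- `FLle R w L`: the word `w` can be converted to the empty word by moves (i)–(iii)
with every intermediate word of length at most `L`. -/
def FLle {A : Type*} (R : Set (Word A)) (w : Word A) (L : ℕ) : Prop :=
  ∃ (m : ℕ) (f : ℕ → Word A), f 0 = w ∧ f m = [] ∧
    (∀ i < m, Move R (f i) (f (i + 1))) ∧ ∀ i ≤ m, (f i).length ≤ L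

/-- `FFLle R w L`: the word `w` can be converted to the empty word by moves (i)–(iv)
with every intermediate word of length at most `L`. -/
def FFLle {A : Type*} (R : Set (Word A)) (w : Word A) (L : ℕ) : Prop :=
  ∃ (m : ℕ) (f : ℕ → Word A), f 0 = w ∧ f m = [] ∧
    (∀ i < m, MoveC R (f i) (f (i + 1))) ∧ ∀ i ≤ m, (f i).length ≤ L

/-- The total length of a finite sequence of words. -/
def totalLength {A : Type*} (l : List (Word A)) : ℕ := (l.map List.length).sum

/-- `FFFLle R w L`: the length-one sequence `(w)` can be converted to a sequence of empty
words by moves (i)–(v) with every intermediate sequence of total length at most `L`. -/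
def FFFLle {A : Type*} (R : Set (Word A)) (w : Word A) (L : ℕ) : Prop :=
  ∃ (m : ℕ) (f : ℕ → List (Word A)), f 0 = [w] ∧ (∀ u ∈ f m, u = ([] : Word A)) ∧
    (∀ i < m, MoveF R (f i) (f (i + 1))) ∧ ∀ i ≤ m, totalLength (f i) ≤ L

/-- An element `x` of the free group is a conjugate of a relator of `R` or of an inverse
of a relator. -/
def IsConjRelator {A : Type*} (R : Set (Word A)) (x : FreeGroup A) : Prop :=
  ∃ c ρ : FreeGroup A, (ρ ∈ FreeGroup.mk '' R ∨ ρ⁻¹ ∈ FreeGroup.mk '' R) ∧ x = c * ρ * c⁻¹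

/-- `AreaLe R g N`: in the free group, `g` is a product of at most `N` conjugates
of elements of `R ∪ R⁻¹`. -/
def AreaLe {A : Type*} (R : Set (Word A)) (g : FreeGroup A) (N : ℕ) : Prop :=
  ∃ l : List (FreeGroup A), l.length ≤ N ∧ (∀ x ∈ l, IsConjRelator R x) ∧ l.prod = g

/-- The number of occurrences in `w` of the letter `x` or its inverse. -/
def countLtr {A : Type*} [DecidableEq A] (x : A) (w : Word A) : ℕ :=
  (w.filter fun p => p.1 = x).length

/-- The filling length `FL(w)` of a null-homotopic word. -/
noncomputable def FLw {A : Type*} (R : Set (Word A)) (w : Word A) : ℕ :=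
  sInf {L | FLle R w L}

/-- The free filling length `FFL(w)` of a null-homotopic word. -/
noncomputable def FFLw {A : Type*} (R : Set (Word A)) (w : Word A) : ℕ :=
  sInf {L | FFLle R w L}

/-- The fragmenting free filling length `FFFL(w)` of a null-homotopic word. -/
noncomputable def FFFLw {A : Type*} (R : Set (Word A)) (w : Word A) : ℕ :=
  sInf {L | FFFLle R w L}

/-- The filling length function `FL : ℕ → ℕ` of the presentation with relators `R`. -/
noncomputable def FLfn {A : Type*} (R : Set (Word A)) (n : ℕ) : ℕ :=
  sSup (FLw R '' {w | NullHomotopic R w ∧ w.length ≤ n})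

/-- The free filling length function `FFL : ℕ → ℕ`. -/
noncomputable def FFLfn {A : Type*} (R : Set (Word A)) (n : ℕ) : ℕ :=
  sSup (FFLw R '' {w | NullHomotopic R w ∧ w.length ≤ n})

/-- The fragmenting free filling length function `FFFL : ℕ → ℕ`. -/
noncomputable def FFFLfn {A : Type*} (R : Set (Word A)) (n : ℕ) : ℕ :=
  sSup (FFFLw R '' {w | NullHomotopic R w ∧ w.length ≤ n})

/-! The presentation `Q = ⟨a, b, r, s, t | a^b a⁻², [t,a], [r,at], [r,s], [s,t]⟩`. -/

/-- The five generators of the presentation `Q`. -/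
inductive QGen | a | b | r | s | t
deriving DecidableEq

/-- The five relators of `Q`: `b⁻¹aba⁻¹a⁻¹`, `t⁻¹a⁻¹ta`, `r⁻¹t⁻¹a⁻¹rat`,
`r⁻¹s⁻¹rs`, `s⁻¹t⁻¹st`. -/
def QRels : Set (Word QGen) :=
  { [(QGen.b, false), (QGen.a, true), (QGen.b, true), (QGen.a, false), (QGen.a, false)],
    [(QGen.t, false), (QGen.a, false), (QGen.t, true), (QGen.a, true)],
    [(QGen.r, false), (QGen.t, false), (QGen.a, false), (QGen.r, true), (QGen.a, true),
      (QGen.t, true)],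
    [(QGen.r, false), (QGen.s, false), (QGen.r, true), (QGen.s, true)],
    [(QGen.s, false), (QGen.t, false), (QGen.s, true), (QGen.t, true)] }

/-- The word `bⁿ`. -/
def bpow (n : ℕ) : Word QGen := List.replicate n (QGen.b, true)

/-- The word `b⁻ⁿ`. -/
def bpowInv (n : ℕ) : Word QGen := List.replicate n (QGen.b, false)

/-- The word `a^{-bⁿ} = b⁻ⁿ a⁻¹ bⁿ`. -/
def aConjNeg (n : ℕ) : Word QGen := bpowInv n ++ [(QGen.a, false)] ++ bpow n

/-- The word `a^{bⁿ} = b⁻ⁿ a bⁿ`. -/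
def aConjPos (n : ℕ) : Word QGen := bpowInv n ++ [(QGen.a, true)] ++ bpow n

/-- The word `a^{-bⁿ} r a^{bⁿ}`. -/
def gword (n : ℕ) : Word QGen := aConjNeg n ++ [(QGen.r, true)] ++ aConjPos n

/-- The word `w_n = [s, a^{-bⁿ} r a^{bⁿ}] = s⁻¹ (b⁻ⁿa⁻¹bⁿ r b⁻ⁿabⁿ)⁻¹ s (b⁻ⁿa⁻¹bⁿ r b⁻ⁿabⁿ)`. -/
def wn (n : ℕ) : Word QGen :=
  [(QGen.s, false)] ++ Word.inv (gword n) ++ [(QGen.s, true)] ++ gword n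

/-- The word `a^{-bⁿ} r a^{bⁿ} r a^{bⁿ} r⁻¹ a^{-bⁿ}`. -/
def g'word (n : ℕ) : Word QGen :=
  aConjNeg n ++ [(QGen.r, true)] ++ aConjPos n ++ [(QGen.r, true)] ++ aConjPos n ++
    [(QGen.r, false)] ++ aConjNeg n

/-- The word `w'_n = [s, a^{-bⁿ} r a^{bⁿ} r a^{bⁿ} r⁻¹ a^{-bⁿ}]`. -/
def w'n (n : ℕ) : Word QGen :=
  [(QGen.s, false)] ++ Word.inv (g'word n) ++ [(QGen.s, true)] ++ g'word n

/-- The four generators of `Q₂ = ⟨a, b, r, t | a^b a⁻², [t,a], [r,at]⟩`. -/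
inductive Q2Gen | a | b | r | t
deriving DecidableEq

/-- The relators `b⁻¹aba⁻¹a⁻¹`, `t⁻¹a⁻¹ta` and `r⁻¹t⁻¹a⁻¹rat` of `Q₂`. -/
def Q2Rels : Set (Word Q2Gen) :=
  { [(Q2Gen.b, false), (Q2Gen.a, true), (Q2Gen.b, true), (Q2Gen.a, false), (Q2Gen.a, false)],
    [(Q2Gen.t, false), (Q2Gen.a, false), (Q2Gen.t, true), (Q2Gen.a, true)],
    [(Q2Gen.r, false), (Q2Gen.t, false), (Q2Gen.a, false), (Q2Gen.r, true), (Q2Gen.a, true),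
      (Q2Gen.t, true)] }

namespace Q2

open Relation

section Derivations

variable {A : Type*}

theorem inv_append (u v : Word A) : Word.inv (u ++ v) = Word.inv v ++ Word.inv u := by
  simp [Word.inv]

theorem inv_inv (u : Word A) : Word.inv (Word.inv u) = u := by
  simp [Word.inv, List.map_reverse, Function.comp_def]

theorem length_inv (u : Word A) : (Word.inv u).length = u.length := by
  simp [Word.inv]

theorem isCyclicConj_iff {u v : Word A} : Word.IsCyclicConj u v ↔ u ~r v := by
  constructor
  · rintro ⟨x, y, rfl, rfl⟩
    exact List.isRotated_append
  · intro h
    obtain ⟨n, hn, rfl⟩ := List.isRotated_iff_mod.1 h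
    exact ⟨u.take n, u.drop n, (List.take_append_drop n u).symm,
      List.rotate_eq_drop_append_take hn⟩

theorem isCyclicConj_inv {u v : Word A} (h : Word.IsCyclicConj u v) :
    Word.IsCyclicConj (Word.inv u) (Word.inv v) := by
  obtain ⟨x, y, rfl, rfl⟩ := h
  exact ⟨Word.inv y, Word.inv x, inv_append _ _, inv_append _ _⟩

variable {R : Set (Word A)}

theorem move_symm {u v : Word A} (h : Move R u v) : Move R v u := by
  cases h with
  | freeReduce u v x b => exact .freeExpand u v x b
  | freeExpand u v x b => exact .freeReduce u v x b
  | relator p q u v z hz hR =>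
    refine .relator p q v u (Word.inv z) ?_ (by rw [inv_inv]; exact hR.symm)
    simpa [inv_append, inv_inv] using isCyclicConj_inv hz

theorem move_inv {u v : Word A} (h : Move R u v) : Move R (Word.inv u) (Word.inv v) := by
  cases h with
  | freeReduce u v x b =>
    simpa [Word.inv] using Move.freeReduce (R := R) (Word.inv v) (Word.inv u) x b
  | freeExpand u v x b =>
    simpa [Word.inv] using Move.freeExpand (R := R) (Word.inv v) (Word.inv u) x b
  | relator p q u v z hz hR =>
    have := Move.relator (R := R) (Word.inv q) (Word.inv p) (Word.inv u) (Word.inv v)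
      (Word.inv z) ?_ (by rw [inv_inv]; exact hR.symm)
    · simpa [inv_append] using this
    · have h := isCyclicConj_inv hz
      rw [isCyclicConj_iff] at h ⊢
      refine List.IsRotated.trans ?_ h
      simpa [inv_append, inv_inv] using List.isRotated_append (l := Word.inv u) (l' := v)

theorem move_append {u v : Word A} (h : Move R u v) (p q : Word A) :
    Move R (p ++ u ++ q) (p ++ v ++ q) := by
  cases h with
  | freeReduce u v x b =>
    simpa using Move.freeReduce (R := R) (p ++ u) (v ++ q) x b
  | freeExpand u v x b =>
    simpa using Move.freeExpand (R := R) (p ++ u) (v ++ q) x b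
  | relator p₁ q₁ u v z hz hR =>
    simpa using Move.relator (R := R) (p ++ p₁) (q₁ ++ q) u v z hz hR

/-- `Reach R N u v`: the word `u` can be converted to `v` by moves between words of length
at most `N`. -/
def Reach (R : Set (Word A)) (N : ℕ) : Word A → Word A → Prop :=
  ReflTransGen fun u v => Move R u v ∧ u.length ≤ N ∧ v.length ≤ N

theorem Reach.refl {N : ℕ} (u : Word A) : Reach R N u u := ReflTransGen.refl

theorem Reach.of_eq {N : ℕ} {u v : Word A} (h : u = v) : Reach R N u v := h ▸ Reach.refl u

theorem Reach.trans {N : ℕ} {u v w : Word A} (h : Reach R N u v) (h' : Reach R N v w) :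
    Reach R N u w := ReflTransGen.trans h h'

theorem Reach.lift {M N : ℕ} {u v : Word A} (h : Reach R M u v) (f : Word A → Word A)
    (hf : ∀ u v, Move R u v → Move R (f u) (f v)) (hN : ∀ u, u.length ≤ M → (f u).length ≤ N) :
    Reach R N (f u) (f v) := by
  induction h with
  | refl => exact .refl _
  | tail _ h ih => exact ih.trans (.single ⟨hf _ _ h.1, hN _ h.2.1, hN _ h.2.2⟩)

theorem Reach.mono {M N : ℕ} {u v : Word A} (h : Reach R M u v) (hMN : M ≤ N) :
    Reach R N u v :=
  h.lift id (fun _ _ => id) fun _ h => h.trans hMN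

theorem Reach.symm {N : ℕ} {u v : Word A} (h : Reach R N u v) : Reach R N v u := by
  induction h with
  | refl => exact .refl _
  | tail _ h ih => exact Reach.trans (.single ⟨move_symm h.1, h.2.2, h.2.1⟩) ih

theorem Reach.inv {N : ℕ} {u v : Word A} (h : Reach R N u v) :
    Reach R N (Word.inv u) (Word.inv v) :=
  h.lift Word.inv (fun _ _ => move_inv) fun u hu => (length_inv u).trans_le hu

theorem Reach.append {M N : ℕ} {u v u' v' : Word A} (h : Reach R M u v) (p q : Word A)
    (hN : M + p.length + q.length ≤ N) (hu : u' = p ++ u ++ q) (hv : v' = p ++ v ++ q) :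
    Reach R N u' v' := by
  subst hu hv
  refine h.lift (fun w => p ++ w ++ q) (fun _ _ h => move_append h p q) fun w hw => ?_
  simp only [List.length_append]
  omega

theorem Reach.cancel {N : ℕ} (x : A) (b : Bool) (p q : Word A)
    (hN : p.length + q.length + 2 ≤ N) :
    Reach R N (p ++ (x, b) :: (x, !b) :: q) (p ++ q) :=
  .single ⟨.freeReduce p q x b, by simp; omega, by simp; omega⟩

theorem Reach.relator {N : ℕ} {u v z : Word A} (hz : Word.IsCyclicConj (u ++ Word.inv v) z)
    (hR : z ∈ R ∨ Word.inv z ∈ R) (hu : u.length ≤ N) (hv : v.length ≤ N) : Reach R N u v :=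
  .single ⟨by simpa using Move.relator [] [] u v z hz hR, hu, hv⟩

theorem Reach.flle {N : ℕ} {w : Word A} (h : Reach R N w []) (hw : w.length ≤ N) :
    FLle R w N := by
  induction h using ReflTransGen.head_induction_on with
  | refl => exact ⟨0, fun _ => [], rfl, rfl, by simp, by simp⟩
  | @head w w' h _ ih =>
    obtain ⟨m, f, h0, hm, hmove, hlen⟩ := ih h.2.2
    refine ⟨m + 1, fun i => Nat.casesOn i w f, rfl, hm, ?_, ?_⟩
    · rintro (_ | i) hi
      · simpa [h0] using h.1
      · exact hmove i (by omega)
    · rintro (_ | i) hi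
      · exact hw
      · exact hlen i (by omega)

theorem Reach.cancel_inv {N : ℕ} (u : Word A) (hN : 2 * u.length ≤ N) :
    Reach R N (Word.inv u ++ u) [] := by
  induction u with
  | nil => exact .refl _
  | cons x u ih =>
    simp only [List.length_cons] at hN
    refine Reach.trans ?_ (ih (by omega))
    have := Reach.cancel (R := R) (N := N) x.1 (!x.2) (Word.inv u) u
      (by rw [length_inv]; omega)
    simpa [Word.inv] using this

theorem Reach.inv_comm {M N : ℕ} {u v : Word A} (h : Reach R M (u ++ v) (v ++ u))
    (hM : M + 2 * u.length ≤ N) (hN : v.length + 3 * u.length ≤ N) :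
    Reach R N (Word.inv u ++ v) (v ++ Word.inv u) := by
  have hc : Reach R (2 * u.length) (Word.inv u ++ u) [] := .cancel_inv u le_rfl
  have hc' : Reach R (2 * u.length) (u ++ Word.inv u) [] := by
    have := Reach.cancel_inv (R := R) (Word.inv u) le_rfl
    rwa [inv_inv, length_inv] at this
  have hl := length_inv u
  have h1 : Reach R N (Word.inv u ++ v) (Word.inv u ++ v ++ u ++ Word.inv u) :=
    hc'.symm.append (Word.inv u ++ v) [] (by simp; omega) (by simp) (by simp)
  have h2 : Reach R N (Word.inv u ++ v ++ u ++ Word.inv u)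
      (Word.inv u ++ u ++ v ++ Word.inv u) :=
    h.symm.append (Word.inv u) (Word.inv u) (by omega) (by simp) (by simp)
  have h3 : Reach R N (Word.inv u ++ u ++ v ++ Word.inv u) (v ++ Word.inv u) :=
    hc.append [] (v ++ Word.inv u) (by simp; omega) (by simp) (by simp)
  exact h1.trans (h2.trans h3)

end Derivations

/-- Derivations over `Q₂` in bounded space. -/
abbrev QReach (N : ℕ) : Word Q2Gen → Word Q2Gen → Prop := Reach Q2Rels N

/-- The word `at`. -/
abbrev uWord : Word Q2Gen := [(.a, true), (.t, true)]

theorem reach_b {N : ℕ} (hN : 3 ≤ N) :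
    QReach N [(.a, true), (.a, true), (.b, false)] [(.b, false), (.a, true)] :=
  Reach.symm <| .relator ⟨_, [], (List.append_nil _).symm, rfl⟩
    (.inl (by simp [Q2Rels, Word.inv])) (by simp; omega) (by simp; omega)

theorem reach_b_neg {N : ℕ} (hN : 4 ≤ N) :
    QReach N [(.a, true), (.b, false), (.a, false), (.b, true)] [(.a, false)] :=
  .relator ⟨[(.a, true), (.b, false), (.a, false), (.b, true)], [(.a, true)], rfl, rfl⟩
    (.inr (by simp [Q2Rels, Word.inv])) (by simp; omega) (by simp; omega)

theorem reach_t {N : ℕ} (hN : 2 ≤ N) :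
    QReach N [(.t, true), (.a, true)] [(.a, true), (.t, true)] :=
  .relator ⟨[(.t, true), (.a, true)], [(.t, false), (.a, false)], rfl, rfl⟩
    (.inl (by simp [Q2Rels])) (by simp; omega) (by simp; omega)

theorem reach_u_a {N : ℕ} (hN : 3 ≤ N) :
    QReach N (uWord ++ [(.a, true)]) ([(.a, true)] ++ uWord) :=
  (reach_t le_rfl).append [(.a, true)] [] (by simp; omega) (by simp) (by simp)

theorem reach_u_r {N : ℕ} (hN : 3 ≤ N) :
    QReach N (uWord ++ [(.r, true)]) ([(.r, true)] ++ uWord) :=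
  Reach.symm <| .relator ⟨[(.r, true), (.a, true), (.t, true)],
    [(.r, false), (.t, false), (.a, false)], rfl, rfl⟩
    (.inl (by simp [Q2Rels])) (by simp; omega) (by simp; omega)

/-- A word of logarithmic length representing `aⁿ`. -/
def aWord (n : ℤ) : Word Q2Gen :=
  if n = 0 then [] else if n = -1 then [(.a, false)] else
    (if n % 2 = 0 then [] else [(.a, true)]) ++ (.b, false) :: aWord (n / 2) ++ [(.b, true)]
termination_by n.natAbs
decreasing_by omega

theorem aWord_zero : aWord 0 = [] := by rw [aWord]; simp

theorem aWord_neg_one : aWord (-1) = [(.a, false)] := by rw [aWord]; simp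

theorem aWord_even {m : ℤ} (hm : m ≠ 0) :
    aWord (2 * m) = (.b, false) :: aWord m ++ [(.b, true)] := by
  rw [aWord, if_neg (by omega), if_neg (by omega), if_pos (by omega),
    show 2 * m / 2 = m by omega, List.nil_append]

theorem aWord_odd {m : ℤ} (hm : m ≠ -1) :
    aWord (2 * m + 1) = (.a, true) :: (.b, false) :: aWord m ++ [(.b, true)] := by
  rw [aWord, if_neg (by omega), if_neg (by omega), if_neg (by omega),
    show (2 * m + 1) / 2 = m by omega]
  simp

theorem length_aWord {s : ℕ} {n : ℤ} (h₁ : -2 ^ s ≤ n) (h₂ : n < 2 ^ s) :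
    (aWord n).length ≤ 3 * s + 1 := by
  induction s generalizing n with
  | zero =>
    obtain rfl | rfl : n = 0 ∨ n = -1 := by simp at h₁ h₂; omega
    · simp [aWord_zero]
    · simp [aWord_neg_one]
  | succ s ih =>
    have := @ih (n / 2) (by rw [pow_succ] at *; omega) (by rw [pow_succ] at *; omega)
    rw [aWord]
    split_ifs <;> simp <;> omega

theorem reach_a_aWord {s : ℕ} {n : ℤ} (h₁ : -2 ^ s ≤ n) (h₂ : n < 2 ^ s) :
    QReach (3 * s + 10) ((.a, true) :: aWord n) (aWord (n + 1)) := by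
  have zero : ∀ {N}, 3 ≤ N → QReach N ((.a, true) :: aWord 0) (aWord (0 + 1)) := by
    intro N hN
    have := aWord_odd (m := 0) (by omega)
    simp only [mul_zero] at this
    rw [this, aWord_zero]
    exact (Reach.cancel Q2Gen.b false [(.a, true)] [] (by simpa using hN)).symm
  have neg_one : ∀ {N}, 3 ≤ N → QReach N ((.a, true) :: aWord (-1)) (aWord (-1 + 1)) := by
    intro N hN
    rw [aWord_neg_one, show (-1 + 1 : ℤ) = 0 by rfl, aWord_zero]
    exact Reach.cancel Q2Gen.a true [] [] (by simp; omega)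
  induction s generalizing n with
  | zero =>
    obtain rfl | rfl : n = 0 ∨ n = -1 := by simp at h₁ h₂; omega
    · exact zero (by omega)
    · exact neg_one (by omega)
  | succ s ih =>
    rw [pow_succ] at h₁ h₂
    obtain ⟨m, rfl | rfl⟩ := Int.even_or_odd' n
    · obtain rfl | hm := eq_or_ne m 0
      · exact zero (by omega)
      obtain rfl | hm' := eq_or_ne m (-1)
      · rw [show (2 * (-1) + 1 : ℤ) = -1 by rfl, aWord_even hm, aWord_neg_one]
        exact reach_b_neg (by omega)
      · rw [aWord_even hm, aWord_odd hm']
        exact .refl _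
    · obtain rfl | hm := eq_or_ne m (-1)
      · exact neg_one (by omega)
      · have hl := @length_aWord s m (by omega) (by omega)
        rw [aWord_odd hm, show 2 * m + 1 + 1 = 2 * (m + 1) by ring,
          aWord_even (m := m + 1) (by omega)]
        have h := (reach_b le_rfl).append [] (aWord m ++ [(.b, true)])
          (N := 3 * (s + 1) + 10) (by simp; omega) rfl rfl
        refine Reach.trans (by simpa using h) ?_
        exact (@ih m (by omega) (by omega)).append [(.b, false)] [(.b, true)]
          (by simp; omega) (by simp) (by simp)

theorem reach_a_inv_aWord {s : ℕ} {n : ℤ} (h₁ : -2 ^ s ≤ n) (h₂ : n < 2 ^ s) :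
    QReach (3 * s + 11) ((.a, false) :: aWord (n + 1)) (aWord n) := by
  have hl := length_aWord h₁ h₂
  have h := (reach_a_aWord h₁ h₂).symm.append [(.a, false)] [] (N := 3 * s + 11)
    (by simp) rfl rfl
  refine Reach.trans (by simpa using h) ?_
  exact Reach.cancel Q2Gen.a false [] _ (by simp; omega)

/-- A second word of logarithmic length representing `aⁿ`. -/
def aWord' (n : ℤ) : Word Q2Gen := Word.inv (aWord (-n))

theorem reach_aWord'_a {s : ℕ} {n : ℤ} (h₁ : -2 ^ s ≤ n) (h₂ : n < 2 ^ s) :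
    QReach (3 * s + 11) (aWord' n ++ [(.a, true)]) (aWord' (n + 1)) := by
  have h := (reach_a_inv_aWord (n := -(n + 1)) (s := s) (by omega) (by omega)).inv
  simpa [aWord', Word.inv] using h

theorem length_aWord' {s : ℕ} {n : ℤ} (h₁ : -2 ^ s < n) (h₂ : n ≤ 2 ^ s) :
    (aWord' n).length ≤ 3 * s + 1 := by
  rw [aWord', length_inv]
  exact length_aWord (by omega) (by omega)

theorem reach_shift {x : Word Q2Gen} (hx : QReach 10 (x ++ [(.a, true)]) ([(.a, true)] ++ x))
    (hxl : x.length ≤ 2) {s : ℕ} {k m : ℤ} (hk : -2 ^ s < k) (hk' : k < 2 ^ s)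
    (hm : -2 ^ s ≤ m) (hm' : m < 2 ^ s) :
    QReach (6 * s + 20) (aWord' k ++ x ++ aWord (m + 1)) (aWord' (k + 1) ++ x ++ aWord m) := by
  have hlk := length_aWord' hk hk'.le
  have hlm := length_aWord hm hm'
  have h1 : QReach (6 * s + 20) (aWord' k ++ x ++ aWord (m + 1))
      (aWord' k ++ x ++ [(.a, true)] ++ aWord m) :=
    (reach_a_aWord hm hm').symm.append (aWord' k ++ x) [] (by simp; omega) (by simp) (by simp)
  have h2 : QReach (6 * s + 20) (aWord' k ++ x ++ [(.a, true)] ++ aWord m)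
      (aWord' k ++ [(.a, true)] ++ x ++ aWord m) :=
    hx.append (aWord' k) (aWord m) (by omega) (by simp) (by simp)
  have h3 : QReach (6 * s + 20) (aWord' k ++ [(.a, true)] ++ x ++ aWord m)
      (aWord' (k + 1) ++ x ++ aWord m) :=
    (reach_aWord'_a hk.le hk').append [] (x ++ aWord m) (by simp; omega) (by simp) (by simp)
  exact h1.trans (h2.trans h3)

theorem reach_aWord_aWord' {x : Word Q2Gen}
    (hx : QReach 10 (x ++ [(.a, true)]) ([(.a, true)] ++ x)) (hxl : x.length ≤ 2)
    {s : ℕ} {n : ℤ} (hn : n.natAbs < 2 ^ s) :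
    QReach (6 * s + 20) (x ++ aWord n) (aWord' n ++ x) := by
  have hn' : (n.natAbs : ℤ) < 2 ^ s := by exact_mod_cast hn
  have key : ∀ k : ℕ, k ≤ n.natAbs → QReach (6 * s + 20) (x ++ aWord n)
      (aWord' (n.sign * k) ++ x ++ aWord (n - n.sign * k)) := by
    intro k hk
    induction k with
    | zero => exact .of_eq (by simp [aWord', aWord_zero, Word.inv])
    | succ k ih =>
      refine (ih (by omega)).trans ?_
      obtain h | h | h := lt_trichotomy n 0
      · rw [Int.sign_eq_neg_one_of_neg h]
        have := reach_shift hx hxl (s := s) (k := -1 * (k + 1 : ℕ)) (m := n - -1 * k)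
          (by omega) (by omega) (by omega) (by omega)
        convert this.symm using 4 <;> push_cast <;> ring
      · omega
      · rw [Int.sign_eq_one_of_pos h]
        have := reach_shift hx hxl (s := s) (k := 1 * k) (m := n - 1 * (k + 1 : ℕ))
          (by omega) (by omega) (by omega) (by omega)
        convert this using 4 <;> push_cast <;> ring
  have := key _ le_rfl
  rw [Int.sign_mul_natAbs, sub_self, aWord_zero] at this
  simpa using this

theorem reach_comm_aWord {x : Word Q2Gen}
    (hx : QReach 10 (x ++ [(.a, true)]) ([(.a, true)] ++ x)) (hxl : x.length ≤ 2)
    {s : ℕ} {n : ℤ} (hn : n.natAbs < 2 ^ s) :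
    QReach (6 * s + 22) (x ++ aWord n) (aWord n ++ x) := by
  have h := reach_aWord_aWord' (x := []) (.refl _) (by simp) hn
  refine ((reach_aWord_aWord' hx hxl hn).mono (by omega)).trans ?_
  exact h.symm.append [] x (by simp; omega) (by simp) (by simp)

/-- The word `(at)ʲ`. -/
def uPow : ℤ → Word Q2Gen
  | .ofNat k => (List.replicate k uWord).flatten
  | .negSucc k => (List.replicate (k + 1) (Word.inv uWord)).flatten

theorem length_uPow (j : ℤ) : (uPow j).length = 2 * j.natAbs := by
  cases j <;> simp [uPow, Word.inv] <;> omega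

theorem reach_u_uPow (j : ℤ) {N : ℕ} (hN : 2 * j.natAbs + 4 ≤ N) :
    QReach N (uWord ++ uPow j) (uPow (j + 1)) := by
  cases j with
  | ofNat k => exact .of_eq (by
      rw [show Int.ofNat k + 1 = Int.ofNat (k + 1) by rfl]
      simp [uPow, List.replicate_succ])
  | negSucc k =>
    have hk : uPow (Int.negSucc k + 1) = (List.replicate k (Word.inv uWord)).flatten := by
      cases k with
      | zero => rfl
      | succ k => rfl
    rw [hk]
    have hc := Reach.cancel_inv (R := Q2Rels) (Word.inv uWord) le_rfl
    refine hc.append [] (List.replicate k (Word.inv uWord)).flatten ?_ ?_ ?_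
    · simp [Word.inv] at hN ⊢; omega
    · simp [uPow, List.replicate_succ, inv_inv]
    · simp

theorem reach_uPow_comm {M : ℕ} {y : Word Q2Gen} (h : QReach M (uWord ++ y) (y ++ uWord))
    (hinv : QReach M (Word.inv uWord ++ y) (y ++ Word.inv uWord)) (j : ℤ) :
    QReach (M + 2 * j.natAbs) (uPow j ++ y) (y ++ uPow j) := by
  have key : ∀ x : Word Q2Gen, x.length = 2 → QReach M (x ++ y) (y ++ x) → ∀ k : ℕ,
      QReach (M + 2 * k) ((List.replicate k x).flatten ++ y)
        (y ++ (List.replicate k x).flatten) := by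
    intro x hx hxy k
    induction k with
    | zero => exact .of_eq (by simp)
    | succ k ih =>
      have h1 := ih.append x [] (N := M + 2 * (k + 1)) (by simp; omega) rfl rfl
      have h2 := hxy.append [] (List.replicate k x).flatten (N := M + 2 * (k + 1))
        (by simp [hx]; omega) rfl rfl
      simp only [List.replicate_succ, List.flatten_cons]
      simpa using h1.trans (.trans (.of_eq (by simp)) h2)
  cases j with
  | ofNat k => exact key _ rfl h k
  | negSucc k => exact key _ rfl hinv (k + 1)

/-- The word `a` or the empty word. -/
def aEps (e : Bool) : Word Q2Gen := if e then [(.a, true)] else []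

theorem reach_b_even (m : ℤ) {s : ℕ} (hm : (2 * m).natAbs < 2 ^ s) {N : ℕ} (hN : 3 * s + 10 ≤ N) :
    QReach N ((.b, true) :: aWord (2 * m)) (aWord m ++ [(.b, true)]) := by
  obtain rfl | h := eq_or_ne m 0
  · exact .of_eq (by simp [aWord_zero])
  · have hl := @length_aWord s m (by zify at hm; grind) (by zify at hm; grind)
    rw [aWord_even h]
    exact Reach.cancel (R := Q2Rels) (N := N) Q2Gen.b true [] (aWord m ++ [(.b, true)])
      (by simp; omega)

theorem reach_b_aWord (n : ℤ) {s : ℕ} (hn : n.natAbs < 2 ^ s) {N : ℕ} (hN : 6 * s + 35 ≤ N) :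
    QReach N ((.b, true) :: aWord n)
      (aWord (n / 2) ++ (.b, true) :: aEps (decide (n % 2 = 1))) := by
  obtain ⟨m, rfl | rfl⟩ := Int.even_or_odd' n
  · rw [show 2 * m / 2 = m by omega, decide_eq_false (by omega)]
    exact reach_b_even m hn (by omega)
  · rw [show (2 * m + 1) / 2 = m by omega, decide_eq_true (by omega)]
    have hs : (2 * m).natAbs < 2 ^ (s + 1) := by rw [pow_succ]; omega
    have h1 := (reach_a_aWord (n := 2 * m) (s := s + 1) (by zify at hs; grind)
      (by zify at hs; grind)).symm.append [(.b, true)] [] (N := N) (by simp; omega) rfl rfl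
    have h2 := (reach_comm_aWord (x := [(.a, true)]) (.refl _) (by simp) hs).append
      [(.b, true)] [] (N := N) (by simp; omega) rfl rfl
    have h3 := (reach_b_even m hs le_rfl).append [] [(.a, true)] (N := N)
      (by simp; omega) rfl rfl
    simp only [List.nil_append, List.cons_append, List.append_assoc, List.append_nil] at h1 h2 h3
    exact h1.trans (h2.trans (h3.trans (.of_eq rfl)))

theorem reach_uPow_aWord (j n : ℤ) {s : ℕ} (hn : n.natAbs < 2 ^ s) :
    QReach (6 * s + 22 + 2 * j.natAbs) (uPow j ++ aWord n) (aWord n ++ uPow j) := by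
  have h : QReach 10 (uWord ++ [(.a, true)]) ([(.a, true)] ++ uWord) := reach_u_a (by simp)
  have h' : QReach 10 (Word.inv uWord ++ [(.a, true)]) ([(.a, true)] ++ Word.inv uWord) :=
    (reach_u_a le_rfl).inv_comm (by simp) (by simp)
  exact reach_uPow_comm (reach_comm_aWord h (by simp) hn)
    (reach_comm_aWord h' (by simp [Word.inv]) hn) j

theorem reach_uPow_r (j : ℤ) :
    QReach (10 + 2 * j.natAbs) (uPow j ++ [(.r, true)]) ([(.r, true)] ++ uPow j) :=
  reach_uPow_comm (reach_u_r (by simp)) ((reach_u_r le_rfl).inv_comm (by simp) (by simp)) j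

/-- The syllables of normal forms: `r^{±1} aⁿ`, `b aᵉ (at)ʲ` and `b⁻¹ (at)ʲ`. -/
inductive Item
  | r (s : Bool) (n : ℤ)
  | b (e : Bool) (j : ℤ)
  | binv (j : ℤ)

/-- The word represented by a syllable. -/
def Item.word : Item → Word Q2Gen
  | .r s n => (.r, s) :: aWord n
  | .b e j => (.b, true) :: aEps e ++ uPow j
  | .binv j => (.b, false) :: uPow j

/-- `Item.Compat x y`: the syllable `x` does not cancel against the syllable `y` following it. -/
def Item.Compat : Item → Item → Prop
  | .r s n, .r s' _ => ¬ (n = 0 ∧ s' = !s)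
  | .b e j, .binv _ => ¬ (e = false ∧ j = 0)
  | .binv j, .b _ _ => j ≠ 0
  | _, _ => True

/-- The number of binary digits of an integer. -/
def bits (n : ℤ) : ℕ := n.natAbs.size

theorem bits_le {n : ℤ} {k : ℕ} : bits n ≤ k ↔ n.natAbs < 2 ^ k := Nat.size_le

theorem natAbs_lt_bits (n : ℤ) : n.natAbs < 2 ^ bits n := Nat.lt_size_self _

theorem bits_le_add_one {m n : ℤ} (h : m.natAbs ≤ 2 * n.natAbs + 1) : bits m ≤ bits n + 1 := by
  rw [bits_le, pow_succ]
  have := natAbs_lt_bits n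
  omega

theorem bits_half (n : ℤ) : bits (n / 2) ≤ bits n := by
  rw [bits_le]
  have := natAbs_lt_bits n
  omega

@[simp] theorem bits_zero : bits 0 = 0 := by simp [bits]

theorem length_aWord_le (n : ℤ) : (aWord n).length ≤ 3 * bits n + 1 := by
  have := natAbs_lt_bits n
  zify at this
  exact length_aWord (by grind) (by grind)

/-- An upper bound for the length of the word of a syllable. -/
def Item.size : Item → ℕ
  | .r _ n => 3 * bits n + 2
  | .b _ j => 2 * j.natAbs + 2
  | .binv j => 2 * j.natAbs + 2

theorem Item.length_word_le (x : Item) : x.word.length ≤ x.size := by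
  cases x with
  | r s n => have := length_aWord_le n; simp [word, size]; omega
  | b e j => cases e <;> simp [word, size, aEps, length_uPow]
  | binv j => simp [word, size, length_uPow]

/-- The triple `(n, j, l)` stands for the product of `aⁿ (at)ʲ` and the syllables in `l`. -/
abbrev RawForm := ℤ × ℤ × List Item

namespace RawForm

/-- The word represented by a list of syllables. -/
def tailWord (l : List Item) : Word Q2Gen := (l.map Item.word).flatten

/-- An upper bound for the length of the word of a list of syllables. -/
def tailSize (l : List Item) : ℕ := (l.map Item.size).sum

@[simp] theorem tailWord_cons (x : Item) (l : List Item) :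
    tailWord (x :: l) = x.word ++ tailWord l := by simp [tailWord]

@[simp] theorem tailSize_cons (x : Item) (l : List Item) :
    tailSize (x :: l) = x.size + tailSize l := by simp [tailSize]

theorem length_tailWord_le (l : List Item) : (tailWord l).length ≤ tailSize l := by
  induction l with
  | nil => simp [tailWord]
  | cons x l ih => have := x.length_word_le; simp; omega

/-- The word represented by a triple. -/
def word (x : RawForm) : Word Q2Gen := aWord x.1 ++ uPow x.2.1 ++ tailWord x.2.2

/-- An upper bound for the length of the word of a triple. -/
def size (x : RawForm) : ℕ := 3 * bits x.1 + 2 * x.2.1.natAbs + tailSize x.2.2 + 1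

theorem length_word_le (x : RawForm) : x.word.length ≤ x.size := by
  have h₁ := length_aWord_le x.1
  have h₂ := length_tailWord_le x.2.2
  simp [word, size, length_uPow]
  omega

/-- A triple is reduced if no two neighbouring syllables cancel. -/
def Reduced (x : RawForm) : Prop := x.2.2.IsChain Item.Compat

/-- Left multiplication by `r` or `r⁻¹`. -/
def rMul (s : Bool) : RawForm → RawForm
  | (n, j, .r s' m :: l) =>
    if n = 0 ∧ s' = !s then (m, j, l) else (0, j, .r s n :: .r s' m :: l)
  | (n, j, l) => (0, j, .r s n :: l)

/-- Left multiplication by `b`. -/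
def bMul : RawForm → RawForm
  | (n, j, .binv k :: l) =>
    if j = 0 ∧ n % 2 = 0 then (n / 2, k, l)
    else (n / 2, 0, .b (decide (n % 2 = 1)) j :: .binv k :: l)
  | (n, j, l) => (n / 2, 0, .b (decide (n % 2 = 1)) j :: l)

/-- Left multiplication by `b⁻¹`. -/
def binvMul : RawForm → RawForm
  | (n, j, .b e k :: l) =>
    if j = 0 then (if e then 2 * n + 1 else 2 * n, k, l)
    else (2 * n, 0, .binv j :: .b e k :: l)
  | (n, j, l) => (2 * n, 0, .binv j :: l)

theorem reduced_rMul (s : Bool) {x : RawForm} (h : Reduced x) : Reduced (rMul s x) := by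
  obtain ⟨n, j, _ | ⟨_ | _ | _, l⟩⟩ := x <;> simp only [rMul] <;> try split_ifs
  all_goals simp_all [Reduced, List.isChain_cons, Item.Compat]

theorem reduced_bMul {x : RawForm} (h : Reduced x) : Reduced (bMul x) := by
  obtain ⟨n, j, _ | ⟨_ | _ | _, l⟩⟩ := x <;> simp only [bMul] <;> try split_ifs
  all_goals simp_all [Reduced, List.isChain_cons, Item.Compat]
  all_goals grind

theorem reduced_binvMul {x : RawForm} (h : Reduced x) : Reduced (binvMul x) := by
  obtain ⟨n, j, _ | ⟨_ | _ | _, l⟩⟩ := x <;> simp only [binvMul] <;> try split_ifs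
  all_goals simp_all [Reduced, List.isChain_cons, Item.Compat]

theorem rMul_rMul (s : Bool) {x : RawForm} (h : Reduced x) : rMul (!s) (rMul s x) = x := by
  obtain ⟨n, j, _ | ⟨⟨s', m⟩ | _ | _, l⟩⟩ := x <;> try (simp [rMul]; done)
  by_cases hc : n = 0 ∧ s' = !s
  · obtain ⟨rfl, rfl⟩ := hc
    obtain _ | ⟨_ | _ | _, l⟩ := l <;> simp_all [Reduced, Item.Compat, rMul]
  · simp [rMul, hc]

theorem binvMul_bMul {x : RawForm} (h : Reduced x) : binvMul (bMul x) = x := by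
  obtain ⟨n, j, _ | ⟨_ | _ | _, l⟩⟩ := x <;> simp only [bMul] <;> try split_ifs
  all_goals try (simp [binvMul]; omega)
  obtain _ | ⟨_ | _ | _, l⟩ := l <;>
    simp_all [Reduced, Item.Compat, binvMul] <;> omega

theorem bMul_binvMul {x : RawForm} (h : Reduced x) : bMul (binvMul x) = x := by
  obtain ⟨n, j, _ | ⟨_ | ⟨_ | _, _⟩ | _, l⟩⟩ := x <;> simp only [binvMul] <;> try split_ifs
  all_goals try (simp [bMul]; done)
  all_goals
    obtain _ | ⟨_ | _ | _, l⟩ := l <;>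
      simp_all [Reduced, Item.Compat, bMul] <;> omega

theorem size_rMul_le (s : Bool) (x : RawForm) : size (rMul s x) ≤ size x + 6 := by
  obtain ⟨n, j, _ | ⟨_ | _ | _, l⟩⟩ := x <;> simp only [rMul] <;> try split_ifs
  all_goals simp [size, Item.size]
  all_goals omega

theorem size_bMul_le (x : RawForm) : size (bMul x) ≤ size x + 6 := by
  have := bits_half x.1
  obtain ⟨n, j, _ | ⟨_ | _ | _, l⟩⟩ := x <;> simp only [bMul] <;> try split_ifs
  all_goals simp [size, Item.size] at this ⊢
  all_goals omega

theorem size_binvMul_le (x : RawForm) : size (binvMul x) ≤ size x + 6 := by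
  have h := bits_le_add_one (m := 2 * x.1) (n := x.1) (by omega)
  have h' := bits_le_add_one (m := 2 * x.1 + 1) (n := x.1) (by omega)
  obtain ⟨n, j, _ | ⟨_ | ⟨_ | _, _⟩ | _, l⟩⟩ := x <;> simp only [binvMul] <;> try split_ifs
  all_goals simp [size, Item.size] at h h' ⊢
  all_goals omega

theorem reach_rMul (x : RawForm) :
    QReach (2 * size x + 60) ((.r, true) :: word x) (word (rMul true x)) := by
  have push : ∀ (n j : ℤ) (l : List Item), QReach (2 * size (n, j, l) + 60)
      ((.r, true) :: word (n, j, l)) (word (0, j, .r true n :: l)) := by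
    intro n j l
    have hn := natAbs_lt_bits n
    have hl := length_tailWord_le l
    have ha := length_aWord_le n
    have h1 := (reach_uPow_aWord j n hn).symm.append [(.r, true)] (tailWord l)
      (N := 2 * size (n, j, l) + 60) (by simp [size]; omega) rfl rfl
    have h2 := (reach_uPow_r j).symm.append [] (aWord n ++ tailWord l)
      (N := 2 * size (n, j, l) + 60) (by simp [size]; omega) rfl rfl
    simp only [List.nil_append, List.cons_append, List.append_assoc] at h1 h2
    simpa [word, Item.word, aWord_zero] using h1.trans h2
  obtain ⟨n, j, _ | ⟨⟨s, m⟩ | _ | _, l⟩⟩ := x <;> simp only [rMul] <;> try exact push _ _ _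
  split_ifs with h
  · obtain ⟨rfl, rfl⟩ := h
    have hm := natAbs_lt_bits m
    have hl := length_tailWord_le l
    have ha := length_aWord_le m
    have h1 := (reach_uPow_r j).symm.append [] ((.r, false) :: aWord m ++ tailWord l)
      (N := 2 * size (0, j, .r false m :: l) + 60) (by simp [size, Item.size]; omega) rfl rfl
    have h2 := Reach.cancel (R := Q2Rels) Q2Gen.r true (uPow j) (aWord m ++ tailWord l)
      (N := 2 * size (0, j, .r false m :: l) + 60)
      (by simp [size, Item.size, length_uPow]; omega)
    have h3 := (reach_uPow_aWord j m hm).append [] (tailWord l)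
      (N := 2 * size (0, j, .r false m :: l) + 60) (by simp [size, Item.size]; omega) rfl rfl
    simp only [List.nil_append, List.cons_append, List.append_assoc,
      Bool.not_true] at h1 h2 h3
    simpa [word, Item.word, aWord_zero] using h1.trans (h2.trans h3)
  · exact push _ _ _

theorem reach_bMul (x : RawForm) :
    QReach (2 * size x + 60) ((.b, true) :: word x) (word (bMul x)) := by
  have push : ∀ (n j : ℤ) (l : List Item), QReach (2 * size (n, j, l) + 60)
      ((.b, true) :: word (n, j, l))
      (word (n / 2, 0, .b (decide (n % 2 = 1)) j :: l)) := by
    intro n j l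
    have hl := length_tailWord_le l
    refine (reach_b_aWord n (natAbs_lt_bits n) le_rfl).append [] (uPow j ++ tailWord l) ?_ ?_ ?_
    · simp [size, length_uPow]; omega
    · simp [word]
    · simp [word, Item.word, uPow]
  obtain ⟨n, j, _ | ⟨_ | _ | k, l⟩⟩ := x <;> simp only [bMul] <;> try exact push _ _ _
  split_ifs with h
  · obtain ⟨rfl, hn⟩ := h
    have hl := length_tailWord_le l
    have hb := bits_half n
    have ha := length_aWord_le (n / 2)
    have h1 := (reach_b_aWord n (natAbs_lt_bits n) le_rfl).append []
      ((.b, false) :: uPow k ++ tailWord l) (N := 2 * size (n, 0, .binv k :: l) + 60)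
      (by simp [size, Item.size, length_uPow]; omega) rfl rfl
    have h2 := Reach.cancel (R := Q2Rels) Q2Gen.b true (aWord (n / 2)) (uPow k ++ tailWord l)
      (N := 2 * size (n, 0, .binv k :: l) + 60)
      (by simp [size, Item.size, length_uPow]; omega)
    simp only [hn, aEps, List.nil_append, List.cons_append, List.append_assoc,
      Bool.not_true, zero_ne_one, decide_false, Bool.false_eq_true, if_false] at h1 h2
    simpa [word, Item.word, uPow] using h1.trans h2
  · exact push _ _ _

end RawForm

open RawForm

/-- Normal forms for elements of the group presented by `Q₂`. -/
abbrev NormalForm := {x : RawForm // Reduced x}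

namespace NormalForm

/-- Left multiplication by `a` as a permutation of the normal forms. -/
def aPerm : Equiv.Perm NormalForm where
  toFun x := ⟨(x.1.1 + 1, x.1.2), x.2⟩
  invFun x := ⟨(x.1.1 - 1, x.1.2), x.2⟩
  left_inv x := by simp
  right_inv x := by simp

/-- Left multiplication by `at` as a permutation of the normal forms. -/
def uPerm : Equiv.Perm NormalForm where
  toFun x := ⟨(x.1.1, x.1.2.1 + 1, x.1.2.2), x.2⟩
  invFun x := ⟨(x.1.1, x.1.2.1 - 1, x.1.2.2), x.2⟩
  left_inv x := by simp
  right_inv x := by simp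

/-- Left multiplication by `r` as a permutation of the normal forms. -/
def rPerm : Equiv.Perm NormalForm where
  toFun x := ⟨rMul true x.1, reduced_rMul _ x.2⟩
  invFun x := ⟨rMul false x.1, reduced_rMul _ x.2⟩
  left_inv x := Subtype.ext (rMul_rMul true x.2)
  right_inv x := Subtype.ext (rMul_rMul false x.2)

/-- Left multiplication by `b` as a permutation of the normal forms. -/
def bPerm : Equiv.Perm NormalForm where
  toFun x := ⟨bMul x.1, reduced_bMul x.2⟩
  invFun x := ⟨binvMul x.1, reduced_binvMul x.2⟩
  left_inv x := Subtype.ext (binvMul_bMul x.2)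
  right_inv x := Subtype.ext (bMul_binvMul x.2)

theorem bPerm_mul_aPerm : bPerm * aPerm * aPerm = aPerm * bPerm := by
  ext1 ⟨⟨n, j, l⟩, h⟩
  apply Subtype.ext
  have h₁ : (n + 1 + 1) / 2 = n / 2 + 1 := by omega
  have h₂ : (n + 1 + 1) % 2 = n % 2 := by omega
  have h₃ : 2 ∣ n + 1 + 1 ↔ 2 ∣ n := by omega
  obtain _ | ⟨_ | _ | _, l⟩ := l <;> simp [bPerm, aPerm, bMul, h₁, h₂, h₃]
  split_ifs <;> rfl

theorem commute_uPerm_aPerm : Commute uPerm aPerm := rfl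

theorem commute_uPerm_rPerm : Commute uPerm rPerm := by
  ext1 ⟨⟨n, j, l⟩, h⟩
  apply Subtype.ext
  obtain _ | ⟨_ | _ | _, l⟩ := l <;> simp [uPerm, rPerm, rMul]
  split_ifs <;> rfl

/-- The action of the generators on the normal forms. -/
def act : Q2Gen → Equiv.Perm NormalForm
  | .a => aPerm
  | .b => bPerm
  | .r => rPerm
  | .t => aPerm⁻¹ * uPerm

theorem lift_act_eq_one {w : Word Q2Gen} (hw : NullHomotopic Q2Rels w) :
    FreeGroup.lift act (FreeGroup.mk w) = 1 := by
  suffices Subgroup.normalClosure (FreeGroup.mk '' Q2Rels) ≤ (FreeGroup.lift act).ker from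
    this hw
  refine Subgroup.normalClosure_le_normal ?_
  rintro _ ⟨z, rfl | rfl | rfl, rfl⟩ <;>
    simp only [SetLike.mem_coe, MonoidHom.mem_ker, FreeGroup.lift_mk, act, List.map_cons,
      List.map_nil, List.prod_cons, List.prod_nil, cond_true, cond_false, mul_one]
  · calc bPerm⁻¹ * (aPerm * (bPerm * (aPerm⁻¹ * aPerm⁻¹)))
        = bPerm⁻¹ * (aPerm * bPerm) * aPerm⁻¹ * aPerm⁻¹ := by group
      _ = 1 := by rw [← bPerm_mul_aPerm]; group
  · calc (aPerm⁻¹ * uPerm)⁻¹ * (aPerm⁻¹ * (aPerm⁻¹ * uPerm * aPerm))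
        = uPerm⁻¹ * aPerm⁻¹ * (uPerm * aPerm) := by group
      _ = 1 := by rw [commute_uPerm_aPerm.eq]; group
  · calc rPerm⁻¹ * ((aPerm⁻¹ * uPerm)⁻¹ * (aPerm⁻¹ * (rPerm * (aPerm * (aPerm⁻¹ * uPerm)))))
        = rPerm⁻¹ * uPerm⁻¹ * (rPerm * uPerm) := by group
      _ = 1 := by rw [← commute_uPerm_rPerm.eq]; group

theorem lift_act_cons (g : Q2Gen) (s : Bool) (w : Word Q2Gen) (x : NormalForm) :
    FreeGroup.lift act (FreeGroup.mk ((g, s) :: w)) x =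
      (cond s (act g) (act g)⁻¹) (FreeGroup.lift act (FreeGroup.mk w) x) := by
  simp only [FreeGroup.lift_mk, List.map_cons, List.prod_cons, Equiv.Perm.mul_apply]

theorem size_act_le (g : Q2Gen) (x : NormalForm) : size (act g x).1 ≤ size x.1 + 6 := by
  obtain ⟨⟨n, j, l⟩, h⟩ := x
  cases g with
  | a =>
    have := bits_le_add_one (m := n + 1) (n := n) (by omega)
    simp [act, aPerm, size]; omega
  | b => exact size_bMul_le _
  | r => exact size_rMul_le _ _
  | t =>
    have := bits_le_add_one (m := n - 1) (n := n) (by omega)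
    simp [act, aPerm, uPerm, size, Equiv.Perm.inv_def]; omega

theorem size_act_inv_le (g : Q2Gen) (x : NormalForm) :
    size ((act g)⁻¹ x).1 ≤ size x.1 + 6 := by
  obtain ⟨⟨n, j, l⟩, h⟩ := x
  cases g with
  | a =>
    have := bits_le_add_one (m := n - 1) (n := n) (by omega)
    simp [act, aPerm, size, Equiv.Perm.inv_def]; omega
  | b => exact size_binvMul_le _
  | r => exact size_rMul_le _ _
  | t =>
    have := bits_le_add_one (m := n + 1) (n := n) (by omega)
    simp [act, aPerm, uPerm, size, Equiv.Perm.inv_def]; omega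

theorem reach_act (g : Q2Gen) (x : NormalForm) :
    QReach (2 * size x.1 + 60) ((g, true) :: word x.1) (word (act g x).1) := by
  cases g with
  | b => exact reach_bMul _
  | r => exact reach_rMul _
  | a =>
    obtain ⟨⟨n, j, l⟩, h⟩ := x
    have hl := length_tailWord_le l
    have hn := natAbs_lt_bits n
    zify at hn
    refine (reach_a_aWord (n := n) (s := bits n) (by grind) (by grind)).append []
      (uPow j ++ tailWord l) ?_ ?_ ?_
    · simp [size, length_uPow]; omega
    · simp [word]
    · simp [word, act, aPerm]
  | t =>
    obtain ⟨⟨n, j, l⟩, h⟩ := x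
    set N := 2 * size (n, j, l) + 60 with hN
    have hw := length_word_le (n, j, l)
    have hl := length_tailWord_le l
    have ha := length_aWord_le n
    have hn := natAbs_lt_bits n
    simp only [size] at hN
    have hu : QReach 10 (uWord ++ [(.a, true)]) ([(.a, true)] ++ uWord) := reach_u_a (by simp)
    have h1 := (Reach.cancel (R := Q2Rels) Q2Gen.a false [] ((.t, true) :: word (n, j, l))
      (N := N) (by simp; omega)).symm
    have h2 := (reach_comm_aWord hu (by simp) hn).append [(.a, false)] (uPow j ++ tailWord l)
      (N := N) (by simp [length_uPow]; omega) rfl rfl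
    have h3 := (reach_u_uPow j le_rfl).append ((.a, false) :: aWord n) (tailWord l)
      (N := N) (by simp; omega) rfl rfl
    have hn' : (n - 1).natAbs < 2 ^ (bits n + 1) := by rw [pow_succ]; omega
    zify at hn'
    have h4 := (reach_a_inv_aWord (n := n - 1) (s := bits n + 1) (by grind) (by grind)).append []
      (uPow (j + 1) ++ tailWord l) (N := N) (by simp [length_uPow]; omega) rfl rfl
    simp only [List.nil_append, List.cons_append, List.append_assoc,
      Bool.not_false, sub_add_cancel, word] at h1 h2 h3 h4
    have := h1.trans (h2.trans (h3.trans h4))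
    simpa [act, aPerm, uPerm, Equiv.Perm.inv_def, word] using this

theorem reach_act_inv (g : Q2Gen) (x : NormalForm) :
    QReach (2 * size x.1 + 75) ((g, false) :: word x.1) (word ((act g)⁻¹ x).1) := by
  have h := reach_act g ((act g)⁻¹ x)
  have hs := size_act_inv_le g x
  have hl := length_word_le ((act g)⁻¹ x).1
  rw [← Equiv.Perm.mul_apply, mul_inv_cancel, Equiv.Perm.one_apply] at h
  refine (h.symm.append [(g, false)] [] (by grind) (by simp) rfl).trans ?_
  simpa using Reach.cancel (R := Q2Rels) g false [] (word ((act g)⁻¹ x).1)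
    (N := 2 * size x.1 + 75) (by grind)

/-- The normal form of the identity. -/
def one : NormalForm := ⟨(0, 0, []), .nil⟩

theorem word_one : word one.1 = [] := by simp [one, word, aWord_zero, uPow, tailWord]

theorem size_lift_le (w : Word Q2Gen) :
    size (FreeGroup.lift act (FreeGroup.mk w) one).1 ≤ 6 * w.length + 1 := by
  induction w with
  | nil => simp [FreeGroup.lift_mk, one, size, tailSize]
  | cons x w ih =>
    obtain ⟨g, _ | _⟩ := x <;> rw [lift_act_cons]
    · exact (size_act_inv_le _ _).trans (by rw [List.length_cons]; omega)
    · exact (size_act_le _ _).trans (by rw [List.length_cons]; omega)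

theorem reach_word (w : Word Q2Gen) :
    QReach (12 * w.length + 77) w (word (FreeGroup.lift act (FreeGroup.mk w) one).1) := by
  induction w with
  | nil => exact .of_eq (by simp [FreeGroup.lift_mk, word_one])
  | cons x w ih =>
    have hs := size_lift_le w
    refine (ih.append [x] [] (by simp) (by simp) rfl).trans ?_
    obtain ⟨g, _ | _⟩ := x <;> rw [lift_act_cons, List.append_nil]
    · exact (reach_act_inv _ _).mono (by rw [List.length_cons]; omega)
    · exact (reach_act _ _).mono (by rw [List.length_cons]; omega)

end NormalForm

end Q2

theorem Q2_FL_linear :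
    ∃ C : ℕ, 0 < C ∧ ∀ w : Word Q2Gen, NullHomotopic Q2Rels w →
      FLle Q2Rels w (C * w.length) := by
  refine ⟨89, by norm_num, fun w hw => ?_⟩
  obtain rfl | hne := eq_or_ne w []
  · exact ⟨0, fun _ => [], rfl, rfl, by simp, by simp⟩
  have hpos : 0 < w.length := List.length_pos_iff.2 hne
  have h := Q2.NormalForm.reach_word w
  rw [Q2.NormalForm.lift_act_eq_one hw, Equiv.Perm.one_apply, Q2.NormalForm.word_one] at h
  exact (h.mono (by omega)).flle (by omega)
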